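/- Let X be a finite abstract simplicial complex of dimension d on n vertices with a complete skeleton. Then the spectral gap satisfies λ(X) ≤ h(X), where h(X) is the d-dimensional Cheeger constant of X. -/

import Mathlib

open Finset

/-- A finite abstract simplicial complex on the vertex type `V`: a collection of finite
subsets of `V` (the cells), closed under taking subsets and containing the empty cell. -/
structure SComplex (V : Type) [Fintype V] [DecidableEq V] : Type where
  cells : Finset (Finset V)
  empty_mem : ∅ ∈ cells
  down_closed : ∀ s ∈ cells, ∀ t ⊆ s, t ∈ cells

namespace SComplex

variable {V : Type} [Fintype V] [DecidableEq V]

/-- The cells of `X` with exactly `m` vertices, i.e. the `(m-1)`-dimensional cells `X^{m-1}`. -/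
def cellsCard (X : SComplex V) (m : ℕ) : Finset (Finset V) :=
  X.cells.filter fun s => s.card = m

/-- `X` is `D`-dimensional: every cell has at most `D+1` vertices and some cell has
exactly `D+1` vertices. -/
def Dim (X : SComplex V) (D : ℕ) : Prop :=
  (∀ s ∈ X.cells, s.card ≤ D + 1) ∧ ∃ s ∈ X.cells, s.card = D + 1

/-- `X` (of dimension `D`) has a complete skeleton: every subset of `V` with at most `D`
elements is a cell. -/
def CompleteSkeleton (X : SComplex V) (D : ℕ) : Prop :=
  ∀ s : Finset V, s.card ≤ D → s ∈ X.cells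

/-- The set of vertices of an ordered tuple. -/
def tset {m : ℕ} (σ : Fin m → V) : Finset V := Finset.image σ Finset.univ

/-- An ordered tuple of vertices is an oriented cell when it is injective and its vertex
set is a cell of `X`. -/
def IsCell (X : SComplex V) {m : ℕ} (σ : Fin m → V) : Prop :=
  Function.Injective σ ∧ tset σ ∈ X.cells

instance (X : SComplex V) {m : ℕ} (σ : Fin m → V) : Decidable (X.IsCell σ) := by
  unfold IsCell; infer_instance

/-- `X.nbr v σ` : the vertex `v` does not belong to `σ` and together with `σ` spans a
cell of `X`. -/
def nbr (X : SComplex V) {m : ℕ} (v : V) (σ : Fin m → V) : Prop :=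
  v ∉ tset σ ∧ insert v (tset σ) ∈ X.cells

instance (X : SComplex V) {m : ℕ} (v : V) (σ : Fin m → V) : Decidable (X.nbr v σ) := by
  unfold nbr; infer_instance

/-- `f` is an `(m-1)`-form on `X`: a function on ordered tuples of `m` vertices which is
skew-symmetric with respect to permutations of the tuple, and is supported on the
oriented `(m-1)`-cells of `X`. -/
def IsForm (X : SComplex V) (m : ℕ) (f : (Fin m → V) → ℝ) : Prop :=
  (∀ (σ : Fin m → V) (π : Equiv.Perm (Fin m)),
      f (σ ∘ π) = ((Equiv.Perm.sign π : ℤ) : ℝ) * f σ) ∧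
  ∀ σ : Fin m → V, ¬ X.IsCell σ → f σ = 0

/-- The space `Ω^{m-1}(X)` of `(m-1)`-forms, as a submodule of the functions on tuples. -/
def formSub (X : SComplex V) (m : ℕ) : Submodule ℝ ((Fin m → V) → ℝ) where
  carrier := {f | X.IsForm m f}
  add_mem' := @fun f g hf hg => ⟨fun σ π => by
      simp only [Pi.add_apply, hf.1 σ π, hg.1 σ π]; ring,
    fun σ h => by simp only [Pi.add_apply, hf.2 σ h, hg.2 σ h, add_zero]⟩
  zero_mem' := ⟨fun σ π => by simp, fun σ h => rfl⟩
  smul_mem' := @fun c f hf => ⟨fun σ π => by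
      simp only [Pi.smul_apply, smul_eq_mul, hf.1 σ π]; ring,
    fun σ h => by simp only [Pi.smul_apply, hf.2 σ h, smul_eq_mul, mul_zero]⟩

/-- The inner product `⟨f,g⟩ = ∑_{σ ∈ X^{m-1}} f(σ) g(σ)` on `(m-1)`-forms, computed via
ordered tuples (each cell is counted `m!` times, once for each ordering of its vertices). -/
noncomputable def innerForm (m : ℕ) (f g : (Fin m → V) → ℝ) : ℝ :=
  ((m.factorial : ℝ))⁻¹ * ∑ σ : Fin m → V, f σ * g σ

/-- The boundary operator `∂ : Ω^m → Ω^{m-1}`, `(∂f)(σ) = ∑_{v ∼ σ} f(vσ)`. -/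
def bdry (X : SComplex V) (m : ℕ) (f : (Fin (m+1) → V) → ℝ) : (Fin m → V) → ℝ :=
  fun σ => ∑ v : V, if X.nbr v σ then f (Fin.cons v σ) else 0

/-- The coboundary operator `∂* : Ω^{m-1} → Ω^m`, `(∂*f)(σ) = ∑ i (-1)^i f(σ ∖ σᵢ)`,
supported on the oriented `m`-cells of `X`. -/
def cobdry (X : SComplex V) (m : ℕ) (f : (Fin m → V) → ℝ) : (Fin (m+1) → V) → ℝ :=
  fun σ => if X.IsCell σ then ∑ i : Fin (m+1), (-1 : ℝ) ^ (i : ℕ) * f (σ ∘ i.succAbove) else 0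

/-- The upper Laplacian `Δ⁺ = ∂ ∘ ∂*` on `(m-1)`-forms. -/
def upLap (X : SComplex V) (m : ℕ) (f : (Fin m → V) → ℝ) : (Fin m → V) → ℝ :=
  X.bdry m (X.cobdry m f)

/-- The lower Laplacian `Δ⁻ = ∂* ∘ ∂` on `m`-forms. -/
def lowLap (X : SComplex V) (m : ℕ) (f : (Fin (m+1) → V) → ℝ) : (Fin (m+1) → V) → ℝ :=
  X.cobdry m (X.bdry m f)

/-- The boundary operator as a linear map. -/
def bdryL (X : SComplex V) (m : ℕ) : ((Fin (m+1) → V) → ℝ) →ₗ[ℝ] ((Fin m → V) → ℝ) where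
  toFun := X.bdry m
  map_add' f g := by
    funext σ
    show (∑ v : V, if X.nbr v σ then (f + g) (Fin.cons v σ) else 0) =
      (∑ v : V, if X.nbr v σ then f (Fin.cons v σ) else 0) +
      (∑ v : V, if X.nbr v σ then g (Fin.cons v σ) else 0)
    rw [← Finset.sum_add_distrib]
    exact Finset.sum_congr rfl fun v _ => by by_cases h : X.nbr v σ <;> simp [h]
  map_smul' c f := by
    funext σ
    show (∑ v : V, if X.nbr v σ then (c • f) (Fin.cons v σ) else 0) =
      c * (∑ v : V, if X.nbr v σ then f (Fin.cons v σ) else 0)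
    rw [Finset.mul_sum]
    exact Finset.sum_congr rfl fun v _ => by by_cases h : X.nbr v σ <;> simp [h]

/-- The coboundary operator as a linear map. -/
def cobdryL (X : SComplex V) (m : ℕ) : ((Fin m → V) → ℝ) →ₗ[ℝ] ((Fin (m+1) → V) → ℝ) where
  toFun := X.cobdry m
  map_add' f g := by
    funext σ
    show X.cobdry m (f + g) σ = X.cobdry m f σ + X.cobdry m g σ
    unfold cobdry
    by_cases h : X.IsCell σ
    · simp only [h, if_true, ← Finset.sum_add_distrib]
      exact Finset.sum_congr rfl fun i _ => by simp [Pi.add_apply]; ring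
    · simp [h]
  map_smul' c f := by
    funext σ
    show X.cobdry m (c • f) σ = c * X.cobdry m f σ
    unfold cobdry
    by_cases h : X.IsCell σ
    · simp only [h, if_true, Finset.mul_sum]
      exact Finset.sum_congr rfl fun i _ => by simp [Pi.smul_apply]; ring
    · simp [h]

/-- The degree of a cell `s`: the number of cells with one more vertex containing `s`. -/
def degCell (X : SComplex V) (s : Finset V) : ℕ :=
  (X.cells.filter fun t => s ⊆ t ∧ t.card = s.card + 1).card

/-- The maximal degree of an `(m-1)`-cell of `X`. -/
def maxDeg (X : SComplex V) (m : ℕ) : ℕ :=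
  (X.cellsCard m).sup fun s => X.degCell s

/-- The spectrum of the upper Laplacian of a `(d+1)`-dimensional complex restricted to
the cycle space `Z = ker ∂` inside the space of forms on `d+1` vertices. -/
def specUpLapZ (X : SComplex V) (d : ℕ) : Set ℝ :=
  {μ | ∃ f : (Fin (d+1) → V) → ℝ,
    X.IsForm (d+1) f ∧ X.bdry d f = 0 ∧ f ≠ 0 ∧ X.upLap (d+1) f = μ • f}

/-- The spectral gap `λ(X) = min Spec (Δ⁺|_Z)` of a `(d+1)`-dimensional complex. -/
noncomputable def spectralGap (X : SComplex V) (d : ℕ) : ℝ :=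
  sInf (X.specUpLapZ d)

/-- `F(A 0, …, A (m-1))`: the set of cells with `m` vertices having exactly one vertex
in each `A i`. -/
def Fcells (X : SComplex V) {m : ℕ} (A : Fin m → Finset V) : Finset (Finset V) :=
  X.cells.filter fun s => s.card = m ∧ ∀ i, (s ∩ A i).card = 1

/-- The Cheeger constant of a `(d+1)`-dimensional complex: the minimum over all
partitions of the vertex set into `d+2` nonempty parts of `n·|F(A₀,…)|/∏|Aᵢ|`. -/
noncomputable def cheeger (X : SComplex V) (d : ℕ) : ℝ :=
  sInf { r : ℝ | ∃ A : Fin (d+2) → Finset V,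
    (∀ i, (A i).Nonempty) ∧ (∀ i j, i ≠ j → Disjoint (A i) (A j)) ∧
    Finset.univ.biUnion A = Finset.univ ∧
    r = (Fintype.card V : ℝ) * ((X.Fcells A).card : ℝ) / ∏ i, ((A i).card : ℝ) }

/-- The `m`-th reduced Betti number `β_m = dim H_m` of `X` over `ℝ`:
`dim (Ω^m ∩ ker ∂_m) - dim (∂_{m+1} Ω^{m+1})`. -/
noncomputable def betti (X : SComplex V) (m : ℕ) : ℕ :=
  Module.finrank ℝ ↥(X.formSub (m+1) ⊓ LinearMap.ker (X.bdryL m)) -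
  Module.finrank ℝ ↥(Submodule.map (X.bdryL (m+1)) (X.formSub (m+2)))

/-- The vertices of the link of `τ`. -/
def linkVerts (X : SComplex V) (τ : Finset V) : Finset V :=
  Finset.univ.filter fun v => v ∉ τ ∧ insert v τ ∈ X.cells

/-- The neighbours of `v` in the link graph of `τ`. -/
def linkNbrs (X : SComplex V) (τ : Finset V) (v : V) : Finset V :=
  Finset.univ.filter fun w => w ≠ v ∧ w ∉ τ ∧ v ∉ τ ∧ insert v (insert w τ) ∈ X.cells

/-- The graph Laplacian of the link of `τ`. -/
def linkLap (X : SComplex V) (τ : Finset V) (g : V → ℝ) : V → ℝ :=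
  fun v => ((X.linkNbrs τ v).card : ℝ) * g v - ∑ w ∈ X.linkNbrs τ v, g w

/-- The graph spectral gap of the link of `τ`: the minimal eigenvalue of its graph
Laplacian on functions on its vertices summing to zero. -/
noncomputable def linkGap (X : SComplex V) (τ : Finset V) : ℝ :=
  sInf {μ : ℝ | ∃ g : V → ℝ, (∀ v, v ∉ X.linkVerts τ → g v = 0) ∧
    (∑ v ∈ X.linkVerts τ, g v = 0) ∧ g ≠ 0 ∧
    ∀ v ∈ X.linkVerts τ, X.linkLap τ g v = μ * g v}

/-- The graph Cheeger constant of the link of `τ`: the minimum over partitions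
`B ⊔ C` of its vertex set of `|W|·|E(B,C)|/(|B|·|C|)`. -/
noncomputable def linkCheeger (X : SComplex V) (τ : Finset V) : ℝ :=
  sInf { r : ℝ | ∃ B C : Finset V, B.Nonempty ∧ C.Nonempty ∧ Disjoint B C ∧
    B ∪ C = X.linkVerts τ ∧
    r = ((X.linkVerts τ).card : ℝ) *
        (((B ×ˢ C).filter fun p => insert p.1 (insert p.2 τ) ∈ X.cells).card : ℝ) /
        ((B.card : ℝ) * (C.card : ℝ)) }

/-- `deg_τ(s)`: the number of neighbours `s'` of the cell `s` which contain `τ` (two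
distinct cells with the same number of vertices are neighbours when their union is a
cell of `X` with one more vertex). -/
def degTau (X : SComplex V) (τ s : Finset V) : ℕ :=
  (X.cells.filter fun s' => s'.card = s.card ∧ s' ≠ s ∧ τ ⊆ s' ∧
    (s ∪ s').card = s.card + 1 ∧ s ∪ s' ∈ X.cells).card

/-- The local upper Laplacian `Δ⁺_τ` associated to a cell `τ` with `d` vertices of a
`(d+1)`-dimensional complex, acting on forms on `d+1` vertices:
`(Δ⁺_τ f)(σ) = deg_τ(σ) f(σ) - ∑_{σ' ∼ σ, τ ⊆ σ'} f(σ')` when `τ ⊆ σ`, and `0` else. -/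
def localUpLap (X : SComplex V) (d : ℕ) (τ : Finset V) (f : (Fin (d+1) → V) → ℝ) :
    (Fin (d+1) → V) → ℝ :=
  fun σ => if τ ⊆ tset σ then
      (X.degTau τ (tset σ) : ℝ) * f σ -
        ∑ v : V, if X.nbr v σ then
          ∑ i : Fin (d+1), if σ i ∉ τ then
            (-1 : ℝ) ^ (i : ℕ) * f (Fin.cons v σ ∘ Fin.succAbove i.succ) else 0
        else 0
    else 0

/-- The complement complex `X̄` of a `D`-dimensional complex `X` with complete skeleton:
it has the same cells of dimension `< D`, and its `D`-dimensional cells are exactly the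
vertex sets of size `D+1` which are not cells of `X`. -/
def complComplex (X : SComplex V) (D : ℕ) (hX : X.CompleteSkeleton D) : SComplex V where
  cells := (X.cells.filter fun s => s.card ≤ D) ∪
    ((Finset.univ : Finset V).powersetCard (D+1)).filter fun s => s ∉ X.cells
  empty_mem := Finset.mem_union_left _ (Finset.mem_filter.mpr ⟨X.empty_mem, by simp⟩)
  down_closed := by
    intro s hs t ht
    rcases Finset.mem_union.mp hs with h | h
    · rw [Finset.mem_filter] at h
      exact Finset.mem_union_left _ (Finset.mem_filter.mpr
        ⟨X.down_closed s h.1 t ht, le_trans (Finset.card_le_card ht) h.2⟩)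
    · rw [Finset.mem_filter, Finset.mem_powersetCard] at h
      by_cases hts : t = s
      · subst hts
        exact Finset.mem_union_right _ (Finset.mem_filter.mpr
          ⟨Finset.mem_powersetCard.mpr h.1, h.2⟩)
      · have hlt : t.card < s.card := Finset.card_lt_card (ht.ssubset_of_ne hts)
        have hsD : s.card = D + 1 := h.1.2
        have htD : t.card ≤ D := by omega
        exact Finset.mem_union_left _ (Finset.mem_filter.mpr ⟨hX t htD, htD⟩)

/-- The simplicial complex on `V` with complete `(d+1)`-dimensional skeleton whose
top-dimensional cells (with `d+2` vertices) are the members of `T`: the Linial–Meshulam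
complex determined by the sample `T`. -/
def lmComplex (V : Type) [Fintype V] [DecidableEq V] (d : ℕ) (T : Finset (Finset V)) :
    SComplex V where
  cells := (Finset.univ.powerset.filter fun s : Finset V => s.card ≤ d + 1) ∪
    T.filter fun s => s.card = d + 2
  empty_mem := Finset.mem_union_left _ (by simp)
  down_closed := by
    intro s hs t ht
    rcases Finset.mem_union.mp hs with h | h
    · rw [Finset.mem_filter] at h
      exact Finset.mem_union_left _ (Finset.mem_filter.mpr
        ⟨Finset.mem_powerset.mpr (Finset.subset_univ t), le_trans (Finset.card_le_card ht) h.2⟩)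
    · rw [Finset.mem_filter] at h
      by_cases hts : t = s
      · subst hts; exact Finset.mem_union_right _ (Finset.mem_filter.mpr h)
      · have hlt : t.card < s.card := Finset.card_lt_card (ht.ssubset_of_ne hts)
        have hsd : s.card = d + 2 := h.2
        have htd : t.card ≤ d + 1 := by omega
        exact Finset.mem_union_left _ (Finset.mem_filter.mpr
          ⟨Finset.mem_powerset.mpr (Finset.subset_univ t), htd⟩)

open Classical in
/-- The probability, under the Linial–Meshulam measure `X(d+1, n, p)` (each possible
top-dimensional cell on `d+2` vertices is included independently with probability `p`),
of an event `E` depending on the set of top-dimensional cells. -/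
noncomputable def lmProb (V : Type) [Fintype V] [DecidableEq V] (d : ℕ) (p : ℝ)
    (E : Finset (Finset V) → Prop) : ℝ :=
  ∑ T ∈ ((Finset.univ : Finset V).powersetCard (d+2)).powerset,
    if E T then
      p ^ T.card * (1 - p) ^ (((Finset.univ : Finset V).powersetCard (d+2)).card - T.card)
    else 0

end SComplex

namespace SComplex

section Skew

variable {V : Type} {m : ℕ}

/-- Skew-symmetric functions on ordered tuples. -/
def IsSkew (f : (Fin m → V) → ℝ) : Prop :=
  ∀ (σ : Fin m → V) (π : Equiv.Perm (Fin m)),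
    f (σ ∘ π) = ((Equiv.Perm.sign π : ℤ) : ℝ) * f σ

/-- The boundary of a function on tuples, with no restriction to the cells of a complex. -/
def sumCons [Fintype V] (f : (Fin (m + 1) → V) → ℝ) (σ : Fin m → V) : ℝ :=
  ∑ v : V, f (Fin.cons v σ)

/-- The coboundary of a function on tuples, with no restriction to the cells of a complex. -/
def altSum (f : (Fin m → V) → ℝ) (σ : Fin (m + 1) → V) : ℝ :=
  ∑ i : Fin (m + 1), (-1 : ℝ) ^ (i : ℕ) * f (σ ∘ i.succAbove)

lemma sign_mul_sign_self (π : Equiv.Perm (Fin m)) :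
    ((Equiv.Perm.sign π : ℤ) : ℝ) * ((Equiv.Perm.sign π : ℤ) : ℝ) = 1 := by
  rw [← Int.cast_mul, Int.units_coe_mul_self, Int.cast_one]

lemma cons_comp_decomposeFin (π : Equiv.Perm (Fin m)) (v : V) (σ : Fin m → V) :
    (Fin.cons v σ : Fin (m + 1) → V) ∘ Equiv.Perm.decomposeFin.symm (0, π) =
      Fin.cons v (σ ∘ π) := by
  funext i
  refine Fin.cases ?_ (fun j => ?_) i <;> simp

lemma IsSkew.cons_comp {f : (Fin (m + 1) → V) → ℝ} (hf : IsSkew f) (v : V) (σ : Fin m → V)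
    (π : Equiv.Perm (Fin m)) :
    f (Fin.cons v (σ ∘ π)) = ((Equiv.Perm.sign π : ℤ) : ℝ) * f (Fin.cons v σ) := by
  rw [← cons_comp_decomposeFin, hf]
  simp

lemma IsSkew.sumCons [Fintype V] {f : (Fin (m + 1) → V) → ℝ} (hf : IsSkew f) :
    IsSkew (sumCons f) := fun σ π => by
  simp only [SComplex.sumCons, hf.cons_comp, Finset.mul_sum]

lemma IsSkew.swap_cons {f : (Fin (m + 2) → V) → ℝ} (hf : IsSkew f) (v w : V)
    (σ : Fin m → V) :
    f (Fin.cons w (Fin.cons v σ)) = -f (Fin.cons v (Fin.cons w σ)) := by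
  have h : (Fin.cons w (Fin.cons v σ) : Fin (m + 2) → V) =
      (Fin.cons v (Fin.cons w σ) : Fin (m + 2) → V) ∘ Equiv.swap 0 1 := by
    funext i
    refine Fin.cases ?_ (fun j => ?_) i
    · simp [← Fin.succ_zero_eq_one, -Fin.succ_zero_eq_one']
    · refine Fin.cases ?_ (fun k => ?_) j
      · simp
      · have h1 : (k.succ.succ : Fin (m + 2)) ≠ 1 := by
          rw [← Fin.succ_zero_eq_one]
          exact fun h => Fin.succ_ne_zero k (Fin.succ_injective _ h)
        simp [Equiv.swap_apply_of_ne_of_ne (Fin.succ_ne_zero k.succ) h1]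
  rw [h, hf, Equiv.Perm.sign_swap (by simp)]
  simp

lemma IsSkew.sumCons_sumCons [Fintype V] {f : (Fin (m + 2) → V) → ℝ} (hf : IsSkew f) :
    SComplex.sumCons (SComplex.sumCons f) = 0 := by
  funext σ
  have h : SComplex.sumCons (SComplex.sumCons f) σ =
      -SComplex.sumCons (SComplex.sumCons f) σ := by
    simp only [SComplex.sumCons]
    conv_lhs => rw [Finset.sum_comm]
    simp only [← Finset.sum_neg_distrib]
    exact Finset.sum_congr rfl fun v _ => Finset.sum_congr rfl fun w _ => hf.swap_cons _ _ _
  simpa using self_eq_neg.mp h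

lemma altSum_eq_sum_sign (f : (Fin m → V) → ℝ) (σ : Fin (m + 1) → V) :
    altSum f σ = ∑ i : Fin (m + 1), ((Equiv.Perm.sign i.cycleRange.symm : ℤ) : ℝ) *
      f (Fin.tail (σ ∘ i.cycleRange.symm)) := by
  refine Finset.sum_congr rfl fun i _ => ?_
  have h : Fin.tail (σ ∘ i.cycleRange.symm) = σ ∘ i.succAbove := by
    funext j
    simp [Fin.tail]
  rw [h]
  simp

lemma IsSkew.sign_mul_tail_congr {f : (Fin m → V) → ℝ} (hf : IsSkew f) (σ : Fin (m + 1) → V)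
    {π ρ : Equiv.Perm (Fin (m + 1))} (h : π 0 = ρ 0) :
    ((Equiv.Perm.sign π : ℤ) : ℝ) * f (Fin.tail (σ ∘ π)) =
      ((Equiv.Perm.sign ρ : ℤ) : ℝ) * f (Fin.tail (σ ∘ ρ)) := by
  obtain ⟨⟨p, e⟩, he⟩ := Equiv.Perm.decomposeFin.symm.surjective (ρ⁻¹ * π)
  have hp : p = 0 := by
    have := congrArg (fun q : Equiv.Perm (Fin (m + 1)) => q 0) he
    simpa [h] using this
  subst hp
  obtain rfl : π = ρ * Equiv.Perm.decomposeFin.symm (0, e) := by rw [he]; group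
  have ht : Fin.tail (σ ∘ (ρ * Equiv.Perm.decomposeFin.symm (0, e))) =
      Fin.tail (σ ∘ ρ) ∘ e := by
    funext j
    simp [Fin.tail]
  rw [ht, hf]
  simp only [Equiv.Perm.sign_mul, Equiv.Perm.decomposeFin.symm_sign, if_true, one_mul,
    Units.val_mul, Int.cast_mul]
  linear_combination ((Equiv.Perm.sign ρ : ℤ) : ℝ) * f (Fin.tail (σ ∘ ρ)) *
    sign_mul_sign_self e

lemma IsSkew.altSum {f : (Fin m → V) → ℝ} (hf : IsSkew f) : IsSkew (altSum f) := by
  intro σ π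
  rw [altSum_eq_sum_sign, altSum_eq_sum_sign, Finset.mul_sum]
  refine Fintype.sum_equiv π _ _ fun i => ?_
  rw [← hf.sign_mul_tail_congr σ (π := π * i.cycleRange.symm) (by simp), Equiv.Perm.sign_mul,
    Units.val_mul, Int.cast_mul, ← mul_assoc, ← mul_assoc, sign_mul_sign_self, one_mul]
  rfl

lemma sum_comp_perm [Fintype V] (F : (Fin m → V) → ℝ) (π : Equiv.Perm (Fin m)) :
    ∑ σ, F (σ ∘ π) = ∑ σ, F σ :=
  Fintype.sum_equiv (π.symm.arrowCongr (Equiv.refl V)) _ _ fun σ => by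
    simp [Equiv.arrowCongr]

lemma sum_cons [Fintype V] (F : (Fin (m + 1) → V) → ℝ) :
    ∑ v, ∑ σ : Fin m → V, F (Fin.cons v σ) = ∑ σ, F σ := by
  rw [← Fintype.sum_prod_type']
  exact Fintype.sum_equiv (Fin.consEquiv fun _ => V) _ _ fun _ => rfl

/-- The unrestricted boundary and coboundary are adjoint, up to the number of orderings. -/
lemma IsSkew.sum_mul_altSum [Fintype V] {g : (Fin (m + 1) → V) → ℝ} (hg : IsSkew g)
    (f : (Fin m → V) → ℝ) :
    ∑ τ, g τ * SComplex.altSum f τ = (m + 1) * ∑ σ, SComplex.sumCons g σ * f σ := by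
  have h : ∀ i : Fin (m + 1), ∑ τ, g τ * (((Equiv.Perm.sign i.cycleRange.symm : ℤ) : ℝ) *
      f (Fin.tail (τ ∘ i.cycleRange.symm))) = ∑ σ, SComplex.sumCons g σ * f σ := by
    intro i
    calc _ = ∑ τ, g (τ ∘ i.cycleRange.symm) * f (Fin.tail (τ ∘ i.cycleRange.symm)) := by
          refine Finset.sum_congr rfl fun τ _ => ?_
          rw [hg]; ring
      _ = ∑ τ, g τ * f (Fin.tail τ) :=
          sum_comp_perm (fun τ => g τ * f (Fin.tail τ)) i.cycleRange.symm
      _ = _ := by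
          rw [← sum_cons, Finset.sum_comm]
          simp [SComplex.sumCons, Finset.sum_mul]
  simp only [altSum_eq_sum_sign, Finset.mul_sum _ _ (g _)]
  rw [Finset.sum_comm, Finset.sum_congr rfl fun i _ => h i]
  simp

end Skew

section TupleSets

variable {V : Type} [DecidableEq V] {m : ℕ}

lemma tset_cons (v : V) (σ : Fin m → V) :
    tset (Fin.cons v σ : Fin (m + 1) → V) = insert v (tset σ) := by
  ext w
  simp [tset, Fin.exists_fin_succ, eq_comm]

lemma tset_comp_perm (σ : Fin m → V) (π : Equiv.Perm (Fin m)) : tset (σ ∘ π) = tset σ := by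
  ext w
  simp only [tset, Finset.mem_image, Finset.mem_univ, true_and, Function.comp_apply]
  exact (π.surjective.exists (p := fun i => σ i = w)).symm

end TupleSets

section Forms

variable {V : Type} [Fintype V] [DecidableEq V] {X : SComplex V} {m : ℕ}

lemma isCell_comp_perm (σ : Fin m → V) (π : Equiv.Perm (Fin m)) :
    X.IsCell (σ ∘ π) ↔ X.IsCell σ := by
  unfold IsCell
  rw [tset_comp_perm, EquivLike.injective_comp]

lemma isCell_cons (v : V) (σ : Fin m → V) :
    X.IsCell (Fin.cons v σ : Fin (m + 1) → V) ↔ Function.Injective σ ∧ X.nbr v σ := by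
  unfold IsCell nbr
  rw [tset_cons, Fin.cons_injective_iff]
  simp [tset]
  tauto

lemma IsForm.bdry_eq {f : (Fin (m + 1) → V) → ℝ} (hf : X.IsForm (m + 1) f) :
    X.bdry m f = sumCons f := by
  funext σ
  refine Finset.sum_congr rfl fun v _ => ?_
  split_ifs with h
  · rfl
  · exact (hf.2 _ fun hc => h ((isCell_cons v σ).mp hc).2).symm

lemma IsForm.bdry {f : (Fin (m + 1) → V) → ℝ} (hf : X.IsForm (m + 1) f) :
    X.IsForm m (X.bdry m f) := by
  rw [hf.bdry_eq]
  refine ⟨IsSkew.sumCons hf.1, fun σ hσ => Finset.sum_eq_zero fun v _ => hf.2 _ fun hc => hσ ?_⟩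
  refine ⟨((isCell_cons v σ).mp hc).1, X.down_closed _ hc.2 _ ?_⟩
  rw [tset_cons]
  exact Finset.subset_insert _ _

lemma IsForm.bdry_bdry {f : (Fin (m + 2) → V) → ℝ} (hf : X.IsForm (m + 2) f) :
    X.bdry m (X.bdry (m + 1) f) = 0 := by
  rw [hf.bdry.bdry_eq, hf.bdry_eq, IsSkew.sumCons_sumCons hf.1]

lemma cobdry_apply (f : (Fin m → V) → ℝ) (σ : Fin (m + 1) → V) :
    X.cobdry m f σ = if X.IsCell σ then altSum f σ else 0 := rfl

lemma IsForm.cobdry {f : (Fin m → V) → ℝ} (hf : X.IsForm m f) :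
    X.IsForm (m + 1) (X.cobdry m f) := by
  refine ⟨fun σ π => ?_, fun σ hσ => if_neg hσ⟩
  simp only [cobdry_apply, isCell_comp_perm, IsSkew.altSum hf.1 σ π, mul_ite, mul_zero]

lemma IsForm.sum_upLap_mul {f g : (Fin m → V) → ℝ} (hf : X.IsForm m f) :
    (m + 1) * ∑ σ, X.upLap m f σ * g σ = ∑ τ, X.cobdry m f τ * X.cobdry m g τ := by
  rw [upLap, hf.cobdry.bdry_eq, ← IsSkew.sum_mul_altSum hf.cobdry.1]
  refine Finset.sum_congr rfl fun τ _ => ?_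
  simp only [cobdry_apply]
  split_ifs <;> simp

end Forms
/-- A symmetric operator on an invariant subspace has an eigenvalue there which is at most
any given Rayleigh quotient. -/
lemma exists_eigenvector_le {ι : Type*} [Fintype ι] (Z : Submodule ℝ (ι → ℝ))
    (T : (ι → ℝ) →ₗ[ℝ] (ι → ℝ)) (hZ : ∀ f ∈ Z, T f ∈ Z)
    (hsymm : ∀ f ∈ Z, ∀ g ∈ Z, ∑ i, T f i * g i = ∑ i, f i * T g i)
    (hpos : ∀ f ∈ Z, 0 ≤ ∑ i, T f i * f i) {f : ι → ℝ} (hfZ : f ∈ Z) (hf : f ≠ 0) :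
    ∃ μ : ℝ, (∃ g ∈ Z, g ≠ 0 ∧ T g = μ • g) ∧ μ * ∑ i, f i ^ 2 ≤ ∑ i, T f i * f i := by
  let e := WithLp.linearEquiv 2 ℝ (ι → ℝ)
  let Z' : Submodule ℝ (EuclideanSpace ℝ ι) := Z.comap e.toLinearMap
  let T' : Z' →ₗ[ℝ] Z' := (e.symm.toLinearMap ∘ₗ T ∘ₗ e.toLinearMap).restrict
    fun x hx => hZ _ hx
  have hinner : ∀ x y : Z', inner ℝ (T' x) y = ∑ i, T (e x) i * e y i := fun x y => by
    rw [Submodule.coe_inner, PiLp.inner_apply]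
    exact Finset.sum_congr rfl fun i _ => mul_comm _ _
  have hT : T'.IsSymmetric := fun x y => by
    rw [hinner, real_inner_comm, hinner]
    refine (hsymm _ x.2 _ y.2).trans ?_
    exact Finset.sum_congr rfl fun i _ => mul_comm _ _
  let f' : Z' := ⟨e.symm f, hfZ⟩
  have hf' : f' ≠ 0 := fun h => hf (congrArg (fun z : Z' => e z) h)
  have : Nontrivial Z' := ⟨⟨f', 0, hf'⟩⟩
  have hev := hT.hasEigenvalue_iInf_of_finiteDimensional
  obtain ⟨x, hx⟩ := hev.exists_hasEigenvector
  refine ⟨⨅ x : { x : Z' // x ≠ 0 }, RCLike.re (inner ℝ (T' x) (x : Z')) / ‖(x : Z')‖ ^ 2,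
    ⟨e x, x.2, fun h => hx.2 (Subtype.ext (e.injective h)), ?_⟩, ?_⟩
  · exact congrArg (fun z : Z' => e z) hx.apply_eq_smul
  · have hle := ciInf_le (f := fun x : { x : Z' // x ≠ 0 } =>
      RCLike.re (inner ℝ (T' x) (x : Z')) / ‖(x : Z')‖ ^ 2) ⟨0, by
        rintro _ ⟨y, rfl⟩
        have : 0 ≤ inner ℝ (T' y) (y : Z') := by
          rw [hinner]; exact hpos _ y.1.2
        exact div_nonneg this (by positivity)⟩ ⟨f', hf'⟩
    have hn : ‖f'‖ ^ 2 = ∑ i, f i ^ 2 := by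
      rw [Submodule.coe_norm, EuclideanSpace.norm_sq_eq]
      simp [f', e]
    have hp : 0 < ‖f'‖ ^ 2 := by positivity
    have h2 := (le_div_iff₀ hp).mp hle
    rw [hn] at h2
    refine h2.trans_eq ?_
    exact hinner f' f'

section Spectrum

variable {V : Type} [Fintype V] [DecidableEq V] {X : SComplex V} {d : ℕ}

lemma IsForm.sum_upLap_mul_self_nonneg {f : (Fin d → V) → ℝ} (hf : X.IsForm d f) :
    0 ≤ ∑ σ, X.upLap d f σ * f σ := by
  have h := hf.sum_upLap_mul (g := f)
  have h2 : 0 ≤ ∑ τ, X.cobdry d f τ * X.cobdry d f τ :=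
    Finset.sum_nonneg fun τ _ => mul_self_nonneg _
  rw [← h] at h2
  exact nonneg_of_mul_nonneg_right h2 (by positivity)

lemma bddBelow_specUpLapZ : BddBelow (X.specUpLapZ d) := by
  refine ⟨0, ?_⟩
  rintro μ ⟨f, hf, -, hf0, hμ⟩
  have h := hf.sum_upLap_mul_self_nonneg
  obtain ⟨σ, hσ⟩ := Function.ne_iff.mp hf0
  have hp : 0 < ∑ σ, f σ * f σ :=
    Finset.sum_pos' (fun _ _ => mul_self_nonneg _)
      ⟨σ, Finset.mem_univ _, mul_self_pos.mpr hσ⟩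
  simp only [hμ, Pi.smul_apply, smul_eq_mul, mul_assoc, ← Finset.mul_sum] at h
  exact nonneg_of_mul_nonneg_left h hp

/-- The variational bound for the spectral gap. -/
lemma spectralGap_mul_le {f : (Fin (d + 1) → V) → ℝ} (hf : X.IsForm (d + 1) f)
    (hbd : X.bdry d f = 0) (hf0 : f ≠ 0) :
    X.spectralGap d * ∑ σ, f σ ^ 2 ≤ ∑ σ, X.upLap (d + 1) f σ * f σ := by
  have hsym : ∀ f, X.IsForm (d + 1) f → ∀ g, X.IsForm (d + 1) g →
      ∑ σ, X.upLap (d + 1) f σ * g σ = ∑ σ, f σ * X.upLap (d + 1) g σ := by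
    intro f hf g hg
    have h1 := hf.sum_upLap_mul (g := g)
    have h2 := hg.sum_upLap_mul (g := f)
    simp only [mul_comm (X.cobdry _ g _)] at h2
    rw [← h2] at h1
    rw [mul_left_cancel₀ (by positivity) h1]
    exact Finset.sum_congr rfl fun _ _ => mul_comm _ _
  obtain ⟨μ, ⟨g, hg, hg0, hgμ⟩, hμ⟩ := exists_eigenvector_le
    (X.formSub (d + 1) ⊓ LinearMap.ker (X.bdryL d)) (X.bdryL (d + 1) ∘ₗ X.cobdryL (d + 1))
    (fun f hf => ⟨IsForm.bdry (IsForm.cobdry hf.1), IsForm.bdry_bdry (IsForm.cobdry hf.1)⟩)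
    (fun f hf g hg => hsym f hf.1 g hg.1)
    (fun f hf => IsForm.sum_upLap_mul_self_nonneg hf.1) (f := f) ⟨hf, hbd⟩ hf0
  refine le_trans ?_ hμ
  exact mul_le_mul_of_nonneg_right (csInf_le bddBelow_specUpLapZ ⟨g, hg.1, hg.2, hg0, hgμ⟩)
    (Finset.sum_nonneg fun _ _ => sq_nonneg _)

end Spectrum
section Coloring

variable {V : Type} {k : ℕ}

/-- The sign of the arrangement of the colors of a tuple, zero when a color is repeated. -/
noncomputable def colorSign (c : V → Fin k) (τ : Fin k → V) : ℝ :=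
  (Matrix.of fun i j => if c (τ i) = j then (1 : ℝ) else 0).det

lemma colorSign_isSkew (c : V → Fin k) : IsSkew (colorSign c) := fun τ π =>
  Matrix.det_permute π (Matrix.of fun i j => if c (τ i) = j then (1 : ℝ) else 0)

lemma colorSign_eq_zero {c : V → Fin k} {τ : Fin k → V} (h : ¬ Function.Injective (c ∘ τ)) :
    colorSign c τ = 0 := by
  simp only [Function.Injective, not_forall] at h
  obtain ⟨i, j, hij, hne⟩ := h
  refine Matrix.det_zero_of_row_eq hne ?_
  funext l
  simp only [Function.comp_apply] at hij
  simp [hij]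

lemma colorSign_of_comp_eq_id {c : V → Fin k} {τ : Fin k → V} (h : c ∘ τ = id) :
    colorSign c τ = 1 := by
  have h1 : (Matrix.of fun i j => if c (τ i) = j then (1 : ℝ) else 0) = 1 := by
    ext i j
    have : c (τ i) = i := congrFun h i
    simp [this, Matrix.one_apply]
  rw [colorSign, h1, Matrix.det_one]

lemma colorSign_sq (c : V → Fin k) (τ : Fin k → V) :
    colorSign c τ ^ 2 = ∑ π : Equiv.Perm (Fin k), if c ∘ (τ ∘ π) = id then 1 else 0 := by
  by_cases h : Function.Injective (c ∘ τ)
  · let ρ : Equiv.Perm (Fin k) := Equiv.ofBijective _ (Finite.injective_iff_bijective.mp h)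
    have hρ : ∀ π : Equiv.Perm (Fin k), c ∘ (τ ∘ π) = id ↔ π = ρ⁻¹ := fun π => by
      rw [eq_inv_iff_mul_eq_one.trans mul_eq_one_comm, Equiv.ext_iff, funext_iff]
      rfl
    have h1 := colorSign_of_comp_eq_id ((hρ ρ⁻¹).mpr rfl)
    rw [colorSign_isSkew] at h1
    simp only [hρ, Finset.sum_ite_eq', Finset.mem_univ, if_true]
    have h2 := sign_mul_sign_self ρ⁻¹
    have h3 : colorSign c τ = ((Equiv.Perm.sign ρ⁻¹ : ℤ) : ℝ) := by
      linear_combination ((Equiv.Perm.sign ρ⁻¹ : ℤ) : ℝ) * h1 - colorSign c τ * h2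
    rw [h3, sq, h2]
  · rw [colorSign_eq_zero h, Finset.sum_eq_zero]
    · simp
    · intro π _
      refine if_neg fun hπ => h ?_
      rw [← EquivLike.injective_comp π (c ∘ τ), Function.comp_assoc, hπ]
      exact Function.injective_id

/-- The squared norm of `colorSign` over a permutation-invariant family of tuples. -/
lemma sum_colorSign_sq [Fintype V] (c : V → Fin k) (p : (Fin k → V) → Prop) [DecidablePred p]
    (hp : ∀ τ (π : Equiv.Perm (Fin k)), p (τ ∘ π) ↔ p τ) :
    ∑ τ, (if p τ then colorSign c τ ^ 2 else 0) =
      k.factorial * #{τ : Fin k → V | c ∘ τ = id ∧ p τ} := by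
  have h : ∀ τ, (if p τ then colorSign c τ ^ 2 else 0) =
      ∑ π : Equiv.Perm (Fin k), if c ∘ (τ ∘ π) = id ∧ p (τ ∘ π) then (1 : ℝ) else 0 := by
    intro τ
    simp only [hp]
    split_ifs with hτ <;> simp [hτ, colorSign_sq]
  simp only [h]
  rw [Finset.sum_comm, Finset.sum_congr rfl fun π _ =>
    sum_comp_perm (fun τ => if c ∘ τ = id ∧ p τ then (1 : ℝ) else 0) π]
  simp [Fintype.card_perm]

lemma altSum_colorSign (c : V → Fin k) : altSum (colorSign c) = 0 := by
  funext τ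
  let M : Matrix (Fin (k + 1)) (Fin (k + 1)) ℝ :=
    Matrix.of fun i j => (Fin.cons 1 fun l => if c (τ i) = l then 1 else 0 : Fin (k + 1) → ℝ) j
  have hdet : M.det = 0 := by
    refine Matrix.exists_mulVec_eq_zero_iff.mp
      ⟨Fin.cons (-1) fun _ => 1, fun h => by simpa using congrFun h 0, ?_⟩
    funext i
    simp [M, Matrix.mulVec, dotProduct, Fin.sum_univ_succ]
  rw [Matrix.det_succ_column_zero] at hdet
  rw [Pi.zero_apply, ← hdet]
  refine Finset.sum_congr rfl fun i _ => ?_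
  simp only [M, Matrix.of_apply, Fin.cons_zero, mul_one]
  rfl

lemma altSum_sumCons_colorSign [Fintype V] (c : V → Fin (k + 1)) :
    altSum (sumCons (colorSign c)) = (Fintype.card V : ℝ) • colorSign c := by
  funext τ
  have h : ∀ v : V, ∑ i : Fin (k + 1), (-1 : ℝ) ^ (i : ℕ) *
      colorSign c (Fin.cons v (τ ∘ i.succAbove)) = colorSign c τ := by
    intro v
    have h0 := congrFun (altSum_colorSign c) (Fin.cons v τ)
    have hs : ∀ i : Fin (k + 1), (Fin.cons v τ : Fin (k + 2) → V) ∘ i.succ.succAbove =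
        Fin.cons v (τ ∘ i.succAbove) := by
      intro i
      funext j
      refine Fin.cases ?_ (fun l => ?_) j <;> simp
    have hz : (Fin.cons v τ : Fin (k + 2) → V) ∘ Fin.succ = τ := rfl
    rw [altSum, Fin.sum_univ_succ] at h0
    simp only [hs, Fin.succAbove_zero, hz, Fin.val_zero, pow_zero, one_mul, Fin.val_succ, pow_succ,
      mul_neg, mul_one, neg_mul, Finset.sum_neg_distrib, Pi.zero_apply] at h0
    linarith
  simp only [altSum, sumCons, Finset.mul_sum]
  rw [Finset.sum_comm, Finset.sum_congr rfl fun v _ => h v]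
  simp

lemma card_comp_eq_id [Fintype V] (c : V → Fin k) :
    #{τ : Fin k → V | c ∘ τ = id} = ∏ i, #{v | c v = i} := by
  rw [← Fintype.card_piFinset]
  congr 1
  ext τ
  simp [funext_iff]

end Coloring

section TestForm

variable {V : Type} [Fintype V] [DecidableEq V] {X : SComplex V} {d : ℕ}

lemma CompleteSkeleton.isCell (hX : X.CompleteSkeleton d) {σ : Fin d → V}
    (hσ : Function.Injective σ) : X.IsCell σ :=
  ⟨hσ, hX _ (Finset.card_image_le.trans (by simp))⟩

lemma CompleteSkeleton.isForm_sumCons_colorSign (hX : X.CompleteSkeleton d)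
    (c : V → Fin (d + 1)) : X.IsForm d (sumCons (colorSign c)) := by
  refine ⟨(colorSign_isSkew c).sumCons, fun σ hσ => Finset.sum_eq_zero fun v _ =>
    colorSign_eq_zero fun h => hσ (hX.isCell ?_)⟩
  exact (Fin.cons_injective_iff.mp h.of_comp).2

lemma spectralGap_mul_card_le (hX : X.CompleteSkeleton (d + 1)) (c : V → Fin (d + 2))
    (hc : Function.Surjective c) :
    X.spectralGap d * #{τ : Fin (d + 2) → V | c ∘ τ = id} ≤
      Fintype.card V * #{τ : Fin (d + 2) → V | c ∘ τ = id ∧ X.IsCell τ} := by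
  set g := colorSign c
  set f := sumCons g
  have hf : X.IsForm (d + 1) f := hX.isForm_sumCons_colorSign c
  have hg : IsSkew g := colorSign_isSkew c
  have hbd : X.bdry d f = 0 := by rw [hf.bdry_eq, hg.sumCons_sumCons]
  have hnorm : ((d + 1 : ℕ) + 1 : ℝ) * ∑ σ, f σ ^ 2 =
      Fintype.card V * ((d + 2).factorial * #{τ : Fin (d + 2) → V | c ∘ τ = id}) := by
    have h := hg.sum_mul_altSum f
    have h2 := sum_colorSign_sq c (fun _ => True) (by simp)
    simp only [if_true, and_true] at h2
    simp only [sq]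
    rw [← h, ← h2, altSum_sumCons_colorSign, Finset.mul_sum]
    exact Finset.sum_congr rfl fun τ _ => by simp [g]; ring
  have hcob : ((d + 1 : ℕ) + 1 : ℝ) * ∑ σ, X.upLap (d + 1) f σ * f σ =
      Fintype.card V ^ 2 *
        ((d + 2).factorial * #{τ : Fin (d + 2) → V | c ∘ τ = id ∧ X.IsCell τ}) := by
    rw [hf.sum_upLap_mul, ← sum_colorSign_sq c X.IsCell isCell_comp_perm, Finset.mul_sum]
    refine Finset.sum_congr rfl fun τ _ => ?_
    rw [cobdry_apply, altSum_sumCons_colorSign]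
    split_ifs
    · simp; ring
    · simp
  have hN : 0 < #{τ : Fin (d + 2) → V | c ∘ τ = id} := by
    obtain ⟨τ, hτ⟩ := hc.hasRightInverse
    exact Finset.card_pos.mpr ⟨τ, Finset.mem_filter.mpr ⟨Finset.mem_univ _, funext hτ⟩⟩
  have hV : (0 : ℝ) < Fintype.card V := by
    obtain ⟨v, -⟩ := hc 0
    exact_mod_cast Fintype.card_pos_iff.mpr ⟨v⟩
  have hfac : (0 : ℝ) < (d + 2).factorial := by positivity
  have hf0 : f ≠ 0 := by
    intro h0
    have hpos := mul_pos hV (mul_pos hfac (Nat.cast_pos.mpr hN))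
    rw [← hnorm, h0] at hpos
    simp at hpos
  have h := mul_le_mul_of_nonneg_left (spectralGap_mul_le hf hbd hf0)
    (by positivity : (0 : ℝ) ≤ (d + 1 : ℕ) + 1)
  rw [hcob, mul_left_comm, hnorm] at h
  refine le_of_mul_le_mul_left ?_ (mul_pos hV hfac)
  linarith

end TestForm

section Partition

variable {V : Type} [Fintype V] [DecidableEq V] {X : SComplex V} {k : ℕ}

lemma card_comp_eq_id_isCell (c : V → Fin k) :
    #{τ : Fin k → V | c ∘ τ = id ∧ X.IsCell τ} = #(X.Fcells fun i => {v | c v = i}) := by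
  have hinter : ∀ τ : Fin k → V, c ∘ τ = id → ∀ i,
      tset τ ∩ ({v | c v = i} : Finset V) = {τ i} := by
    intro τ hτ i
    have hτ' : ∀ j, c (τ j) = j := congrFun hτ
    ext v
    simp only [tset, Finset.mem_inter, Finset.mem_image, Finset.mem_univ, true_and,
      Finset.mem_filter, Finset.mem_singleton]
    constructor
    · rintro ⟨⟨j, rfl⟩, h⟩
      rw [← h, hτ']
    · rintro rfl
      exact ⟨⟨i, rfl⟩, hτ' i⟩
  refine Finset.card_bij (fun τ _ => tset τ) ?_ ?_ ?_
  · intro τ hτ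
    simp only [Finset.mem_filter, Finset.mem_univ, true_and] at hτ
    simp only [Fcells, Finset.mem_filter]
    refine ⟨hτ.2.2, ?_, fun i => ?_⟩
    · rw [tset, Finset.card_image_of_injective _ hτ.2.1]
      simp
    · rw [hinter τ hτ.1 i, Finset.card_singleton]
  · intro τ hτ τ' hτ' h
    simp only [Finset.mem_filter, Finset.mem_univ, true_and] at hτ hτ'
    funext i
    have h1 := hinter τ hτ.1 i
    rw [h, hinter τ' hτ'.1 i] at h1
    exact (Finset.singleton_injective h1).symm
  · intro s hs
    simp only [Fcells, Finset.mem_filter, Finset.card_eq_one] at hs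
    obtain ⟨hsX, hcard, hs⟩ := hs
    choose τ hτ using hs
    have hmem : ∀ i, τ i ∈ s ∧ c (τ i) = i := fun i => by
      have : τ i ∈ s ∩ ({v | c v = i} : Finset V) := by rw [hτ]; simp
      simpa using this
    have hinj : Function.Injective τ := fun i j hij => by
      rw [← (hmem i).2, ← (hmem j).2, hij]
    have hts : tset τ = s := by
      refine Finset.eq_of_subset_of_card_le ?_ ?_
      · intro v hv
        obtain ⟨i, -, rfl⟩ := Finset.mem_image.mp hv
        exact (hmem i).1
      · rw [tset, Finset.card_image_of_injective _ hinj, hcard]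
        simp
    refine ⟨τ, ?_, hts⟩
    simp only [Finset.mem_filter, Finset.mem_univ, true_and]
    exact ⟨funext fun i => (hmem i).2, hinj, hts ▸ hsX⟩

/-- A partition into labelled parts is the family of fibres of a coloring. -/
lemma exists_coloring {A : Fin k → Finset V} (hdisj : ∀ i j, i ≠ j → Disjoint (A i) (A j))
    (hcover : Finset.univ.biUnion A = Finset.univ) :
    ∃ c : V → Fin k, A = fun i => ({v | c v = i} : Finset V) := by
  have h : ∀ v, ∃ i, v ∈ A i := fun v => by
    have : v ∈ Finset.univ.biUnion A := hcover ▸ Finset.mem_univ v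
    simpa using this
  choose c hc using h
  refine ⟨c, funext fun i => Finset.ext fun v => ?_⟩
  simp only [Finset.mem_filter, Finset.mem_univ, true_and]
  refine ⟨fun hv => ?_, fun hv => hv ▸ hc v⟩
  by_contra hne
  exact Finset.disjoint_left.mp (hdisj _ _ hne) (hc v) hv

end Partition

end SComplex

open SComplex in
/-- **Cheeger inequality** (Theorem 1.2): for a finite `(d+1)`-dimensional simplicial
complex `X` on `n` vertices with a complete skeleton, `λ(X) ≤ h(X)`. -/
theorem cheeger_inequality (V : Type) [Fintype V] [DecidableEq V] (d : ℕ)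
    (X : SComplex V) (hdim : X.Dim (d + 1)) (hskel : X.CompleteSkeleton (d + 1)) :
    X.spectralGap d ≤ X.cheeger d := by
  refine le_csInf ?_ ?_
  · obtain ⟨s, -, hs⟩ := hdim.2
    have hcard : Fintype.card (Fin (d + 2)) ≤ Fintype.card V := by
      rw [Fintype.card_fin]
      exact hs ▸ s.card_le_univ
    obtain ⟨e⟩ := Function.Embedding.nonempty_of_card_le hcard
    let c : V → Fin (d + 2) := Function.invFun e
    have hc : Function.Surjective c := Function.invFun_surjective e.injective
    refine ⟨_, fun i => {v | c v = i}, fun i => ?_, fun i j hij => ?_, ?_, rfl⟩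
    · obtain ⟨v, hv⟩ := hc i
      exact ⟨v, by simpa using hv⟩
    · rw [Finset.disjoint_left]
      intro v hi hj
      simp only [Finset.mem_filter, Finset.mem_univ, true_and] at hi hj
      exact hij (hi.symm.trans hj)
    · ext v
      simp
  · rintro r ⟨A, hne, hdisj, hcover, rfl⟩
    obtain ⟨c, rfl⟩ := exists_coloring hdisj hcover
    have hc : Function.Surjective c := fun i => by
      obtain ⟨v, hv⟩ := hne i
      exact ⟨v, by simpa using hv⟩
    have h := spectralGap_mul_card_le hskel c hc
    rw [card_comp_eq_id, card_comp_eq_id_isCell, Nat.cast_prod] at h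
    rw [le_div_iff₀ (Finset.prod_pos fun i _ => Nat.cast_pos.mpr (Finset.card_pos.mpr (hne i)))]
    exact h
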